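/- For every n ≥ 1 there is no invertible n-state Mealy automaton over the binary alphabet {0,1} whose generated group G(A) is isomorphic to the free abelian group ℤ^n of rank n. -/

import Mathlib

/-- The automorphism group of the rooted binary tree `{0,1}*`, realized as the subgroup of
permutations of `List Bool` (finite binary words, with `[]` the root and `w` adjacent to
`w ++ [x]`) consisting of those permutations that fix the root and map children of a vertex
to children of its image (equivalently, bijections fixing the root and preserving adjacency). -/
def binTreeAut : Subgroup (Equiv.Perm (List Bool)) where
  carrier := {f | f [] = [] ∧ ∀ (w : List Bool) (x : Bool), ∃ y : Bool, f (w ++ [x]) = f w ++ [y]}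
  one_mem' := ⟨rfl, fun w x => ⟨x, rfl⟩⟩
  mul_mem' := by
    rintro f g ⟨hf0, hf⟩ ⟨hg0, hg⟩
    refine ⟨by simp [Equiv.Perm.mul_apply, hg0, hf0], ?_⟩
    intro w x
    obtain ⟨y, hy⟩ := hg w x
    obtain ⟨z, hz⟩ := hf (g w) y
    exact ⟨z, by simp [Equiv.Perm.mul_apply, hy, hz]⟩
  inv_mem' := by
    rintro f ⟨hf0, hf⟩
    constructor
    · have h : f⁻¹ (f []) = [] := Equiv.symm_apply_apply f []
      rwa [hf0] at h
    · intro w x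
      have hfv : f (f⁻¹ (w ++ [x])) = w ++ [x] := Equiv.apply_symm_apply f (w ++ [x])
      rcases List.eq_nil_or_concat (f⁻¹ (w ++ [x])) with hnil | ⟨w', x', hcons⟩
      · rw [hnil, hf0] at hfv
        exact absurd hfv.symm (by simp)
      · rw [hcons, List.concat_eq_append] at hfv
        obtain ⟨y, hy⟩ := hf w' x'
        rw [hy] at hfv
        have h2 := List.append_inj' hfv rfl
        have hw' : w' = f⁻¹ w := by
          rw [← h2.1]; exact (Equiv.symm_apply_apply f w').symm
        refine ⟨x', ?_⟩
        rw [hcons, List.concat_eq_append, hw']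

/-- A time-varying automaton over the binary alphabet `{0,1}` (encoded as `Bool`) with state
set `Q`: a sequence of transition functions and a sequence of output functions.  (Indexing of
the transitions starts here at `0`, corresponding to the first transition.) -/
structure TVAutomaton (Q : Type*) where
  phi : ℕ → Q → Bool → Q
  psi : ℕ → Q → Bool → Bool

namespace TVAutomaton

variable {Q : Type*}

/-- An automaton is invertible if all labelings `x ↦ psi i q x` are bijections. -/
def Invertible (A : TVAutomaton Q) : Prop := ∀ i q, Function.Bijective (A.psi i q)

/-- A Mealy automaton is a time-varying automaton whose sequences of transition and output
functions are constant. -/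
def IsMealy (A : TVAutomaton Q) : Prop := ∀ i, A.phi i = A.phi 0 ∧ A.psi i = A.psi 0

/-- The automaton transformation of the state `q` in its `i`-th transition. -/
def act (A : TVAutomaton Q) : ℕ → Q → List Bool → List Bool
  | _, _, [] => []
  | i, q, x :: w => A.psi i q x :: A.act (i + 1) (A.phi i q x) w

/-- The inverse automaton transformation (for invertible automata). -/
noncomputable def invAct (A : TVAutomaton Q) : ℕ → Q → List Bool → List Bool
  | _, _, [] => []
  | i, q, y :: u =>
    Function.invFun (A.psi i q) y ::
      A.invAct (i + 1) (A.phi i q (Function.invFun (A.psi i q) y)) u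

theorem act_invAct (A : TVAutomaton Q) (h : A.Invertible) :
    ∀ (u : List Bool) (i : ℕ) (q : Q), A.act i q (A.invAct i q u) = u := by
  intro u
  induction u with
  | nil => intro i q; rfl
  | cons y u ih =>
    intro i q
    rw [invAct, act, ih]
    congr 1
    exact Function.rightInverse_invFun (h i q).2 y

theorem invAct_act (A : TVAutomaton Q) (h : A.Invertible) :
    ∀ (w : List Bool) (i : ℕ) (q : Q), A.invAct i q (A.act i q w) = w := by
  intro w
  induction w with
  | nil => intro i q; rfl
  | cons x w ih =>
    intro i q
    have hx : Function.invFun (A.psi i q) (A.psi i q x) = x :=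
      Function.leftInverse_invFun (h i q).1 x
    rw [act, invAct, hx, ih]

/-- The automaton transformation of the state `q` in its `i`-th transition, as a
permutation of the set of binary words. -/
noncomputable def toPerm (A : TVAutomaton Q) (h : A.Invertible) (i : ℕ) (q : Q) :
    Equiv.Perm (List Bool) where
  toFun := A.act i q
  invFun := A.invAct i q
  left_inv := fun w => A.invAct_act h w i q
  right_inv := fun u => A.act_invAct h u i q

theorem act_concat (A : TVAutomaton Q) :
    ∀ (w : List Bool) (i : ℕ) (q : Q) (x : Bool),
      ∃ y, A.act i q (w ++ [x]) = A.act i q w ++ [y] := by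
  intro w
  induction w with
  | nil => intro i q x; exact ⟨A.psi i q x, rfl⟩
  | cons a w ih =>
    intro i q x
    obtain ⟨y, hy⟩ := ih (i + 1) (A.phi i q a) x
    refine ⟨y, ?_⟩
    show A.psi i q a :: A.act (i + 1) (A.phi i q a) (w ++ [x]) = _
    rw [hy]; rfl

/-- The automaton transformation of the state `q` in its `i`-th transition, as an
automorphism of the rooted binary tree. -/
noncomputable def toAut (A : TVAutomaton Q) (h : A.Invertible) (i : ℕ) (q : Q) :
    ↥binTreeAut :=
  ⟨A.toPerm h i q, ⟨rfl, fun w x => A.act_concat w i q x⟩⟩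

/-- The group `G(A)` generated by an invertible time-varying automaton `A`: the subgroup of
`Aut({0,1}*)` generated by the transformations of all states of `A` in their first
transition. -/
noncomputable def genGroup (A : TVAutomaton Q) (h : A.Invertible) : Subgroup ↥binTreeAut :=
  Subgroup.closure (Set.range fun q => A.toAut h 0 q)

end TVAutomaton

/-- A tree automorphism belongs to the first level stabilizer: it fixes both one-letter
words. -/
def FixesLevelOne (g : ↥binTreeAut) : Prop :=
  (g : Equiv.Perm (List Bool)) [false] = [false] ∧ (g : Equiv.Perm (List Bool)) [true] = [true]

section SectionVectors

variable {Q : Type*}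

/-- A homomorphism `P` from `ℤ^Q` to permutations of binary words decomposes at `v` compatibly
with `T` if `P v` acts on first letters as translation by some `ε`, its restrictions to both
subtrees lie in the image of `P`, and they have preimages that sum to `T v`. -/
def Decomposes (P : Multiplicative (Q → ℤ) →* Equiv.Perm (List Bool))
    (T : (Q → ℤ) →+ (Q → ℤ)) (v : Q → ℤ) : Prop :=
  ∃ (ε : Bool) (s : Bool → Q → ℤ), s false + s true = T v ∧
    ∀ x w, P (.ofAdd v) (x :: w) = (x ^^ ε) :: P (.ofAdd (s x)) w

variable {P : Multiplicative (Q → ℤ) →* Equiv.Perm (List Bool)} {T : (Q → ℤ) →+ (Q → ℤ)}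

theorem Decomposes.zero : Decomposes P T 0 :=
  ⟨false, fun _ => 0, by simp, by simp⟩

theorem Decomposes.add {u v : Q → ℤ} (hu : Decomposes P T u) (hv : Decomposes P T v) :
    Decomposes P T (u + v) := by
  obtain ⟨ε, s, hs, hP⟩ := hu
  obtain ⟨δ, t, ht, hR⟩ := hv
  refine ⟨δ ^^ ε, fun x => s (x ^^ δ) + t x, ?_, fun x w => ?_⟩
  · rw [map_add, ← hs, ← ht]
    cases δ <;> simp <;> abel
  · rw [ofAdd_add, map_mul, Equiv.Perm.mul_apply, hR, hP, ofAdd_add, map_mul,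
      Equiv.Perm.mul_apply, Bool.xor_assoc]

theorem Decomposes.neg {v : Q → ℤ} (hv : Decomposes P T v) : Decomposes P T (-v) := by
  obtain ⟨ε, s, hs, hP⟩ := hv
  refine ⟨ε, fun x => -s (x ^^ ε), ?_, fun x w => ?_⟩
  · rw [map_neg, ← hs]
    cases ε <;> simp [add_comm]
  · rw [ofAdd_neg, map_inv, Equiv.Perm.inv_eq_iff_eq, hP, ofAdd_neg, map_inv,
      ← Equiv.Perm.mul_apply, mul_inv_cancel, Equiv.Perm.one_apply, Bool.xor_assoc,
      Bool.xor_self, Bool.xor_false]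

theorem Decomposes.of_single [Fintype Q] [DecidableEq Q]
    (h : ∀ q, Decomposes P T (Pi.single q 1)) (v : Q → ℤ) : Decomposes P T v := by
  let S : AddSubgroup (Q → ℤ) :=
    { carrier := {v | Decomposes P T v}
      zero_mem' := .zero
      add_mem' := .add
      neg_mem' := .neg }
  change v ∈ S
  rw [pi_eq_sum_univ' v]
  exact sum_mem fun q _ => zsmul_mem (h q) _

/-- If `T v = 2 v` then `P (2 v)` restricts to itself on both subtrees, hence is trivial. -/
theorem eq_zero_of_map_eq_two_smul (hinj : Function.Injective P)
    (hD : ∀ v, Decomposes P T v) {c : Q → ℤ} {t : Bool → Q → ℤ}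
    (hc : ∀ x w, P (.ofAdd c) (x :: w) = (!x) :: P (.ofAdd (t x)) w)
    {v : Q → ℤ} (hv : T v = v + v) : v = 0 := by
  obtain ⟨ε, s, hs, hP⟩ := hD v
  have key : ∀ x w, P (.ofAdd (v + v)) (x :: w) = x :: P (.ofAdd (v + v)) w := by
    have hmul : ∀ x w, P (.ofAdd (v + v)) (x :: w) = x :: P (.ofAdd (s (x ^^ ε) + s x)) w := by
      intro x w
      rw [ofAdd_add, map_mul, Equiv.Perm.mul_apply, hP, hP, ofAdd_add, map_mul,
        Equiv.Perm.mul_apply, Bool.xor_assoc, Bool.xor_self, Bool.xor_false]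
    cases ε with
    | true =>
      intro x w
      rw [hmul, ← hv, ← hs]
      cases x <;> simp [add_comm]
    | false =>
      have hst : s false = s true := by
        have h1 : P (.ofAdd (t false + s false)) = P (.ofAdd (t false + s true)) := by
          ext1 w
          have h2 : P (.ofAdd (c + v)) (false :: w) = P (.ofAdd (v + c)) (false :: w) := by
            rw [add_comm]
          rw [ofAdd_add, ofAdd_add, map_mul, map_mul, Equiv.Perm.mul_apply,
            Equiv.Perm.mul_apply, hc, hP, hP, hc] at h2
          rw [add_comm _ (s true), ofAdd_add, ofAdd_add, map_mul, map_mul,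
            Equiv.Perm.mul_apply, Equiv.Perm.mul_apply]
          exact (List.cons.inj h2).2
        exact add_left_cancel (Multiplicative.ofAdd.injective (hinj h1))
      intro x w
      rw [hmul, ← hv, ← hs]
      cases x <;> simp [hst]
  have hnil : ∀ u, P (.ofAdd u) [] = [] := by
    intro u
    by_contra hne
    obtain ⟨y, l, hyl⟩ := List.exists_cons_of_ne_nil hne
    obtain ⟨δ, r, -, hr⟩ := hD u
    have h1 := hr (y ^^ δ) ((P (.ofAdd (r (y ^^ δ))))⁻¹ l)
    rw [← Equiv.Perm.mul_apply, mul_inv_cancel, Equiv.Perm.one_apply, Bool.xor_assoc,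
      Bool.xor_self, Bool.xor_false, ← hyl] at h1
    simpa using (P (.ofAdd u)).injective h1
  have hone : P (.ofAdd (v + v)) = P (.ofAdd 0) := by
    ext1 w
    induction w with
    | nil => rw [hnil, hnil]
    | cons x w ih => rw [key, ih]; simp
  have h0 : v + v = 0 := Multiplicative.ofAdd.injective (hinj hone)
  ext q
  have := congrFun h0 q
  simp only [Pi.add_apply, Pi.zero_apply] at this ⊢
  omega

end SectionVectors

/-- Every integer matrix all of whose columns sum to `2` has `2` as an eigenvalue. -/
theorem exists_mulVec_eq_add_self {Q : Type*} [Fintype Q] [DecidableEq Q] [Nonempty Q]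
    (M : Matrix Q Q ℤ) (hM : ∀ q, ∑ p, M p q = 2) :
    ∃ v : Q → ℤ, v ≠ 0 ∧ M.mulVec v = v + v := by
  have hdet : (M - 2).det = 0 := by
    refine Matrix.exists_vecMul_eq_zero_iff.mp ⟨1, one_ne_zero, ?_⟩
    rw [Matrix.vecMul_sub, sub_eq_zero]
    ext q
    have h2 : (2 : Matrix Q Q ℤ) = 1 + 1 := by norm_num
    rw [h2, Matrix.vecMul_add, Matrix.vecMul_one]
    simp [Matrix.vecMul, dotProduct, hM]
  obtain ⟨v, hv, h0⟩ := Matrix.exists_mulVec_eq_zero_iff.mpr hdet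
  refine ⟨v, hv, ?_⟩
  have h2 : (2 : Matrix Q Q ℤ) = 1 + 1 := by norm_num
  rwa [Matrix.sub_mulVec, sub_eq_zero, h2, Matrix.add_mulVec, Matrix.one_mulVec] at h0

/-- A generating family of size `n` of a group isomorphic to `ℤ^n` is a basis. -/
theorem exists_injective_hom_of_closure_range {G : Type*} [Group G] {n : ℕ} (g : Fin n → G)
    (e : Subgroup.closure (Set.range g) ≃* Multiplicative (Fin n → ℤ)) :
    ∃ f : Multiplicative (Fin n → ℤ) →* G, Function.Injective f ∧
      ∀ q, f (.ofAdd (Pi.single q 1)) = g q := by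
  let g' : Fin n → Subgroup.closure (Set.range g) := fun q =>
    ⟨g q, Subgroup.subset_closure ⟨q, rfl⟩⟩
  let L : (Fin n → ℤ) →ₗ[ℤ] (Fin n → ℤ) :=
    Fintype.linearCombination ℤ fun q => (e (g' q)).toAdd
  have hL : ∀ q, L (Pi.single q 1) = (e (g' q)).toAdd := fun q => by
    simp [L, Fintype.linearCombination_apply_single]
  have hsurj : Function.Surjective L := by
    have hmem : ∀ (x : G) (hx : x ∈ Subgroup.closure (Set.range g)),
        (e ⟨x, hx⟩).toAdd ∈ LinearMap.range L := by
      intro x hx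
      induction hx using Subgroup.closure_induction with
      | mem x hx => obtain ⟨q, rfl⟩ := hx; exact ⟨_, hL q⟩
      | one =>
        have : e ⟨1, one_mem _⟩ = 1 := map_one e
        rw [this]
        exact zero_mem _
      | mul x y hx hy ihx ihy =>
        have : e ⟨x * y, mul_mem hx hy⟩ = e ⟨x, hx⟩ * e ⟨y, hy⟩ := map_mul e ⟨x, hx⟩ ⟨y, hy⟩
        rw [this]
        exact add_mem ihx ihy
      | inv x hx ih =>
        have : e ⟨x⁻¹, inv_mem hx⟩ = (e ⟨x, hx⟩)⁻¹ := map_inv e ⟨x, hx⟩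
        rw [this]
        exact neg_mem ih
    intro u
    have := hmem _ (e.symm (.ofAdd u)).2
    simpa using this
  have hinj : Function.Injective L := OrzechProperty.injective_of_surjective_endomorphism L hsurj
  refine ⟨(Subgroup.subtype _).comp
    (e.symm.toMonoidHom.comp (AddMonoidHom.toMultiplicative L.toAddMonoidHom)), ?_, fun q => ?_⟩
  · exact (Subgroup.subtype_injective _).comp (e.symm.injective.comp hinj)
  · have h1 : e.symm (.ofAdd (L (Pi.single q 1))) = g' q := by rw [hL]; simp
    exact congrArg Subtype.val h1

theorem TVAutomaton.IsMealy.act_eq {Q : Type*} {A : TVAutomaton Q} (hA : A.IsMealy)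
    (w : List Bool) : ∀ (i : ℕ) (q : Q), A.act i q w = A.act 0 q w := by
  induction w with
  | nil => intro i q; rfl
  | cons x w ih =>
    intro i q
    rw [act, act, (hA i).1, (hA i).2, ih (i + 1), ih (0 + 1)]

/-- For every `n ≥ 1` there is no invertible `n`-state Mealy automaton over
the binary alphabet whose generated group is isomorphic to the free abelian group of rank
`n`. -/
theorem no_mealy_free_abelian_rank_n (n : ℕ) (hn : 1 ≤ n) :
    ¬ ∃ (A : TVAutomaton (Fin n)) (h : A.Invertible),
        A.IsMealy ∧ Nonempty (A.genGroup h ≃* Multiplicative (Fin n → ℤ)) := by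
  rintro ⟨A, h, hA, ⟨e⟩⟩
  have : Nonempty (Fin n) := ⟨⟨0, hn⟩⟩
  obtain ⟨f, hf, hfq⟩ := exists_injective_hom_of_closure_range _ e
  let P : Multiplicative (Fin n → ℤ) →* Equiv.Perm (List Bool) := binTreeAut.subtype.comp f
  have hinj : Function.Injective P := binTreeAut.subtype_injective.comp hf
  have hPq : ∀ q w, P (.ofAdd (Pi.single q 1)) w = A.act 0 q w := fun q w =>
    congrArg (fun a : binTreeAut => (a : Equiv.Perm (List Bool)) w) (hfq q)
  have hpsi : ∀ q x, A.psi 0 q x = (x ^^ A.psi 0 q false) := by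
    intro q x
    have := (h 0 q).1.ne (show false ≠ true by decide)
    revert this
    cases x <;> cases A.psi 0 q false <;> cases A.psi 0 q true <;> simp
  have hstep : ∀ q x w, P (.ofAdd (Pi.single q 1)) (x :: w) =
      (x ^^ A.psi 0 q false) :: P (.ofAdd (Pi.single (A.phi 0 q x) 1)) w := by
    intro q x w
    rw [hPq, hPq, TVAutomaton.act, hA.act_eq, hpsi]
  let M : Matrix (Fin n) (Fin n) ℤ := .of fun p q =>
    (Pi.single (A.phi 0 q false) 1 + Pi.single (A.phi 0 q true) 1 : Fin n → ℤ) p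
  have hM : ∀ q, ∑ p, M p q = 2 := fun q => by
    simp [M, Finset.sum_add_distrib]
  have hD : ∀ v, Decomposes P M.mulVecLin.toAddMonoidHom v := by
    refine Decomposes.of_single fun q => ⟨_, _, ?_, hstep q⟩
    ext p
    simp [M]
  obtain ⟨q, hq⟩ : ∃ q, A.psi 0 q false = true := by
    by_contra! hno
    have hid : ∀ w q, A.act 0 q w = w := by
      intro w
      induction w with
      | nil => intro q; rfl
      | cons x w ih =>
        intro q
        rw [TVAutomaton.act, hA.act_eq, ih, hpsi, Bool.eq_false_of_not_eq_true (hno q),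
          Bool.xor_false]
    have hone : P (.ofAdd (Pi.single ⟨0, hn⟩ 1)) = P (.ofAdd 0) := by
      ext1 w
      rw [hPq, hid]
      simp
    simpa using congrFun (Multiplicative.ofAdd.injective (hinj hone)) ⟨0, hn⟩
  obtain ⟨v, hv, hMv⟩ := exists_mulVec_eq_add_self M hM
  refine hv (eq_zero_of_map_eq_two_smul hinj hD (c := Pi.single q 1)
    (t := fun x => Pi.single (A.phi 0 q x) 1) (fun x w => ?_) hMv)
  rw [hstep, hq, Bool.xor_true]
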